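/- arXiv:math/9508209 — 4 statements merged into one kernel-verified Lean document; each statement's English description precedes it below -/
import Mathlib

section
/- Let u, x, v, y, w, z be positive reals with u + x + v + y + w + z = 2π, and let A, B, C, D, E, F be the points on the unit circle in ℂ at angles 0, u, u+x, u+x+v, u+x+v+y, u+x+v+y+w respectively (six distinct points in counterclockwise order dividing the circumference into arcs of lengths u, x, v, y, w, z). Then the three chords AD, BE, CF (closed segments) have a common point if and only if sin(u/2)·sin(v/2)·sin(w/2) = sin(x/2)·sin(y/2)·sin(z/2). -/
open Real in
/-- The line through the points of the unit circle at angles `2 * s` and `2 * t`, evaluated at the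
point of angle `2 * r`. -/
theorem cos_mul_cos_add_sin_mul_sin_sub_cos (r s t : ℝ) :
    cos (s + t) * cos (2 * r) + sin (s + t) * sin (2 * r) - cos (t - s) =
      2 * (sin (r - s) * sin (t - r)) := by
  rw [cos_two_mul', sin_two_mul, cos_add, sin_add, cos_sub, sin_sub, sin_sub]
  linear_combination
    (cos s * cos t + sin s * sin t) * sin_sq_add_cos_sq r

open Real in
/-- The determinant of the coefficients of the lines through three pairs of points of the unit
circle, in terms of the half angles of the points. -/
theorem det_chord_lines (a b c d e f : ℝ) :
    cos (d - a) * (cos (b + e) * sin (c + f) - sin (b + e) * cos (c + f)) +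
      cos (e - b) * (cos (c + f) * sin (a + d) - sin (c + f) * cos (a + d)) +
      cos (f - c) * (cos (a + d) * sin (b + e) - sin (a + d) * cos (b + e)) =
    2 * (sin (c - b) * sin (e - d) * sin (f - a) - sin (b - a) * sin (d - c) * sin (f - e)) := by
  simp only [cos_add, sin_add, cos_sub, sin_sub]
  ring

open Real in
theorem sin_sub_plucker (a b c d e f : ℝ) :
    sin (b - a) * sin (e - a) * (sin (d - c) * sin (f - d)) -
      sin (d - b) * sin (e - d) * (sin (c - a) * sin (f - a)) =
    sin (d - a) *
      (sin (b - a) * sin (d - c) * sin (f - e) - sin (c - b) * sin (e - d) * sin (f - a)) := by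
  simp only [sin_sub]
  ring

open Real in
/-- A chord of the unit circle is the intersection of its line with the closed unit disc. -/
theorem mem_segment_exp_iff {s t : ℝ} (h : 0 < sin (t - s)) (p : ℂ) :
    p ∈ segment ℝ (Complex.exp ((2 * s : ℝ) * Complex.I))
        (Complex.exp ((2 * t : ℝ) * Complex.I)) ↔
      cos (s + t) * p.re + sin (s + t) * p.im = cos (t - s) ∧ ‖p‖ ≤ 1 := by
  constructor
  · intro hp
    refine ⟨?_, ?_⟩
    · obtain ⟨μ, ν, -, -, hμν, rfl⟩ := hp
      have hs := cos_mul_cos_add_sin_mul_sin_sub_cos s s t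
      have ht := cos_mul_cos_add_sin_mul_sin_sub_cos t s t
      simp only [sub_self, sin_zero, zero_mul, mul_zero] at hs ht
      simp only [Complex.add_re, Complex.add_im, Complex.smul_re, Complex.smul_im, smul_eq_mul,
        Complex.exp_ofReal_mul_I_re, Complex.exp_ofReal_mul_I_im]
      linear_combination μ * hs + ν * ht + cos (t - s) * hμν
    · have hball := (convex_closedBall (0 : ℂ) 1).segment_subset
        (x := Complex.exp ((2 * s : ℝ) * Complex.I)) (y := Complex.exp ((2 * t : ℝ) * Complex.I))
        (by simp [Complex.norm_exp_ofReal_mul_I, -Complex.ofReal_mul])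
        (by simp [Complex.norm_exp_ofReal_mul_I, -Complex.ofReal_mul]) hp
      simpa using hball
  · rintro ⟨hline, hnorm⟩
    have hsq : p.re ^ 2 + p.im ^ 2 ≤ 1 := by
      have := Complex.sq_norm p
      rw [Complex.normSq_apply] at this
      nlinarith [norm_nonneg p]
    obtain ⟨m, hm⟩ : ∃ m, m = s + t := ⟨_, rfl⟩
    obtain ⟨δ, hδ⟩ : ∃ δ, δ = t - s := ⟨_, rfl⟩
    have hs : 2 * s = m - δ := by linarith
    have ht : 2 * t = m + δ := by linarith
    rw [← hm, ← hδ] at hline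
    rw [← hδ] at h
    rw [hs, ht]
    have hk : |cos m * p.im - sin m * p.re| ≤ sin δ := by
      apply abs_le_of_sq_le_sq _ h.le
      have h1 := sin_sq_add_cos_sq m
      have h2 := sin_sq_add_cos_sq δ
      have h3 : (cos m * p.im - sin m * p.re) ^ 2 = p.re ^ 2 + p.im ^ 2 - cos δ ^ 2 := by
        rw [← hline]
        linear_combination (p.re ^ 2 + p.im ^ 2) * h1
      linarith
    obtain ⟨hk1, hk2⟩ := abs_le.mp hk
    have hre : cos m * cos δ - sin m * (cos m * p.im - sin m * p.re) = p.re := by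
      rw [← hline]
      linear_combination p.re * sin_sq_add_cos_sq m
    have him : sin m * cos δ + cos m * (cos m * p.im - sin m * p.re) = p.im := by
      rw [← hline]
      linear_combination p.im * sin_sq_add_cos_sq m
    generalize cos m * p.im - sin m * p.re = k at *
    refine ⟨(sin δ - k) / (2 * sin δ), (sin δ + k) / (2 * sin δ),
      div_nonneg (by linarith) (by linarith), div_nonneg (by linarith) (by linarith),
      by field_simp; ring, ?_⟩
    apply Complex.ext <;>
      simp only [Complex.add_re, Complex.add_im, Complex.smul_re, Complex.smul_im, smul_eq_mul,
        Complex.exp_ofReal_mul_I_re, Complex.exp_ofReal_mul_I_im, cos_add, cos_sub, sin_add,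
        sin_sub]
    · rw [← hre]
      field_simp
      ring
    · rw [← him]
      field_simp
      ring

open Real in
/-- Concurrency of three chords, in terms of the half angles of their endpoints. -/
theorem chords_concurrent_iff_half_angles {a b c d e f : ℝ} (hab : a < b) (hbc : b < c)
    (hcd : c < d) (hde : d < e) (hef : e < f) (hfa : f < a + π) :
    (∃ p : ℂ,
      p ∈ segment ℝ (Complex.exp ((2 * a : ℝ) * Complex.I))
        (Complex.exp ((2 * d : ℝ) * Complex.I)) ∧
      p ∈ segment ℝ (Complex.exp ((2 * b : ℝ) * Complex.I))
        (Complex.exp ((2 * e : ℝ) * Complex.I)) ∧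
      p ∈ segment ℝ (Complex.exp ((2 * c : ℝ) * Complex.I))
        (Complex.exp ((2 * f : ℝ) * Complex.I))) ↔
      sin (b - a) * sin (d - c) * sin (f - e) = sin (c - b) * sin (e - d) * sin (f - a) := by
  have hpos : ∀ {r : ℝ}, 0 < r → r < π → 0 < sin r := sin_pos_of_pos_of_lt_pi
  have had : 0 < sin (d - a) := hpos (by linarith) (by linarith)
  have hbe : 0 < sin (e - b) := hpos (by linarith) (by linarith)
  have hcf : 0 < sin (f - c) := hpos (by linarith) (by linarith)
  constructor
  · rintro ⟨p, h1, h2, h3⟩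
    have h1 := ((mem_segment_exp_iff had p).mp h1).1
    have h2 := ((mem_segment_exp_iff hbe p).mp h2).1
    have h3 := ((mem_segment_exp_iff hcf p).mp h3).1
    have hdet := det_chord_lines a b c d e f
    rw [← h1, ← h2, ← h3] at hdet
    linear_combination (1 / 2 : ℝ) * hdet
  · intro h
    have hP : 0 < sin (b - a) * sin (e - a) :=
      mul_pos (hpos (by linarith) (by linarith)) (hpos (by linarith) (by linarith))
    have hQ : 0 < sin (d - b) * sin (e - d) :=
      mul_pos (hpos (by linarith) (by linarith)) (hpos (by linarith) (by linarith))
    have hpl := sin_sub_plucker a b c d e f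
    rw [sub_eq_zero.mpr h, mul_zero] at hpl
    have hBA := cos_mul_cos_add_sin_mul_sin_sub_cos a b e
    have hBD := cos_mul_cos_add_sin_mul_sin_sub_cos d b e
    have hCA := cos_mul_cos_add_sin_mul_sin_sub_cos a c f
    have hCD := cos_mul_cos_add_sin_mul_sin_sub_cos d c f
    rw [← neg_sub b a, sin_neg] at hBA
    rw [← neg_sub c a, sin_neg] at hCA
    set P := sin (b - a) * sin (e - a)
    set Q := sin (d - b) * sin (e - d)
    have hPQ : P + Q ≠ 0 := by positivity
    obtain ⟨p, hp⟩ : ∃ p, p = (Q / (P + Q)) • Complex.exp ((2 * a : ℝ) * Complex.I) +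
        (P / (P + Q)) • Complex.exp ((2 * d : ℝ) * Complex.I) := ⟨_, rfl⟩
    have hmem : p ∈ segment ℝ (Complex.exp ((2 * a : ℝ) * Complex.I))
        (Complex.exp ((2 * d : ℝ) * Complex.I)) :=
      ⟨Q / (P + Q), P / (P + Q), by positivity, by positivity, by field_simp; ring, hp.symm⟩
    have hnorm := ((mem_segment_exp_iff had p).mp hmem).2
    have hre : p.re = (Q * cos (2 * a) + P * cos (2 * d)) / (P + Q) := by
      rw [hp]
      simp only [Complex.add_re, Complex.smul_re, smul_eq_mul, Complex.exp_ofReal_mul_I_re]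
      ring
    have him : p.im = (Q * sin (2 * a) + P * sin (2 * d)) / (P + Q) := by
      rw [hp]
      simp only [Complex.add_im, Complex.smul_im, smul_eq_mul, Complex.exp_ofReal_mul_I_im]
      ring
    refine ⟨p, hmem, (mem_segment_exp_iff hbe p).mpr ⟨?_, hnorm⟩,
      (mem_segment_exp_iff hcf p).mpr ⟨?_, hnorm⟩⟩
    · rw [hre, him]
      field_simp
      linear_combination Q * hBA + P * hBD
    · rw [hre, him]
      field_simp
      linear_combination Q * hCA + P * hCD + 2 * hpl

/-- Six points on the unit circle at angles `0, u, u+x, u+x+v, u+x+v+y, u+x+v+y+w`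
(dividing the circle into arcs of lengths `u, x, v, y, w, z`).  The three chords
`AD`, `BE`, `CF` are concurrent iff
`sin(u/2) sin(v/2) sin(w/2) = sin(x/2) sin(y/2) sin(z/2)`. -/
theorem three_chords_concurrent_iff (u x v y w z : ℝ)
    (hu : 0 < u) (hx : 0 < x) (hv : 0 < v) (hy : 0 < y) (hw : 0 < w) (hz : 0 < z)
    (hsum : u + x + v + y + w + z = 2 * Real.pi)
    (A B C D E F : ℂ)
    (hA : A = Complex.exp ((0 : ℝ) * Complex.I))
    (hB : B = Complex.exp ((u : ℝ) * Complex.I))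
    (hC : C = Complex.exp (((u + x : ℝ)) * Complex.I))
    (hD : D = Complex.exp (((u + x + v : ℝ)) * Complex.I))
    (hE : E = Complex.exp (((u + x + v + y : ℝ)) * Complex.I))
    (hF : F = Complex.exp (((u + x + v + y + w : ℝ)) * Complex.I)) :
    (∃ p : ℂ, p ∈ segment ℝ A D ∧ p ∈ segment ℝ B E ∧ p ∈ segment ℝ C F) ↔
      Real.sin (u/2) * Real.sin (v/2) * Real.sin (w/2) =
        Real.sin (x/2) * Real.sin (y/2) * Real.sin (z/2) := by
  subst hA hB hC hD hE hF
  have key := chords_concurrent_iff_half_angles (a := 0) (b := u / 2) (c := (u + x) / 2)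
    (d := (u + x + v) / 2) (e := (u + x + v + y) / 2) (f := (u + x + v + y + w) / 2)
    (by linarith) (by linarith) (by linarith) (by linarith) (by linarith) (by linarith)
  have hsin : Real.sin ((u + x + v + y + w) / 2 - 0) = Real.sin (z / 2) := by
    rw [← Real.sin_pi_sub]
    congr 1
    linarith
  rw [hsin] at key
  convert key using 2 <;> ring_nf
end

section
/- If n ≥ 3 is odd, then no point in the open interior of the regular n-gon lies on three or more diagonals; consequently I(n) = C(n,4). -/
noncomputable section

/-- The regular `n`-gon: the convex hull of the `n`-th roots of unity in `ℂ`. -/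
def Ngon (n : ℕ) : Set ℂ := convexHull ℝ {z : ℂ | z ^ n = 1}

/-- `s` is a diagonal of the regular `n`-gon: the closed segment joining two
distinct non-adjacent vertices. -/
def IsDiagonal (n : ℕ) (s : Set ℂ) : Prop :=
  ∃ v w : ℂ, v ^ n = 1 ∧ w ^ n = 1 ∧ v ≠ w ∧
    w ≠ v * Complex.exp (2 * Real.pi * Complex.I / n) ∧
    v ≠ w * Complex.exp (2 * Real.pi * Complex.I / n) ∧
    s = segment ℝ v w

/-- `I(n)`: the number of points in the open interior of the regular `n`-gon
lying on at least two diagonals. -/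
def numIntersections (n : ℕ) : ℕ :=
  Set.ncard {p : ℂ | p ∈ interior (Ngon n) ∧
    ∃ d₁ d₂ : Set ℂ, IsDiagonal n d₁ ∧ IsDiagonal n d₂ ∧ d₁ ≠ d₂ ∧ p ∈ d₁ ∧ p ∈ d₂}

open Complex ComplexConjugate

/-- For unit complex numbers `a ≠ b`, this says that `p` lies on the line through `a` and `b`. -/
def OnChord (a b p : ℂ) : Prop := p + a * b * conj p = a + b

/-- The open segments `a b` and `c d` cross at `p`. -/
def CrossAt (a b c d p : ℂ) : Prop := p ∈ openSegment ℝ a b ∧ p ∈ openSegment ℝ c d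

lemma mul_conj_of_norm_eq_one {a : ℂ} (ha : ‖a‖ = 1) : a * conj a = 1 := by
  rw [Complex.mul_conj, Complex.normSq_eq_norm_sq, ha]; norm_num

lemma onChord_of_mem_segment {a b p : ℂ} (ha : ‖a‖ = 1) (hb : ‖b‖ = 1)
    (hp : p ∈ segment ℝ a b) : OnChord a b p := by
  obtain ⟨s, t, -, -, hst, rfl⟩ := hp
  have hst' : (s : ℂ) + t = 1 := by exact_mod_cast hst
  have h1 := mul_conj_of_norm_eq_one ha
  have h2 := mul_conj_of_norm_eq_one hb
  simp only [OnChord, Complex.real_smul, map_add, map_mul, Complex.conj_ofReal]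
  linear_combination (s * b) * h1 + t * a * h2 + (a + b) * hst'

lemma OnChord.symm {a b p : ℂ} (h : OnChord a b p) : OnChord b a p := by
  unfold OnChord at *; linear_combination h

/-- Two chords with a common endpoint meet only on the unit circle. -/
lemma OnChord.right_unique {a b d p : ℂ} (ha : ‖a‖ = 1) (hp : ‖p‖ < 1)
    (h₁ : OnChord a b p) (h₂ : OnChord a d p) : b = d := by
  by_contra hbd
  unfold OnChord at *
  have h : (b - d) * (a * conj p - 1) = 0 := by linear_combination h₁ - h₂
  rcases mul_eq_zero.1 h with h | h
  · exact hbd (sub_eq_zero.1 h)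
  · have := congrArg norm (sub_eq_zero.1 h)
    rw [norm_mul, ha, Complex.norm_conj, norm_one, one_mul] at this
    linarith

lemma OnChord.mul_ne_mul {a b c d p : ℂ} (h₁ : OnChord a b p) (h₂ : OnChord c d p)
    (hac : a ≠ c) (had : a ≠ d) : a * b ≠ c * d := by
  intro h
  unfold OnChord at *
  have : (a - c) * (a - d) = 0 := by
    linear_combination (conj p * a - 1) * h - a * h₁ + a * h₂
  rcases mul_eq_zero.1 this with h | h
  · exact hac (sub_eq_zero.1 h)
  · exact had (sub_eq_zero.1 h)

/-- The determinant whose vanishing expresses that the three chords `a b`, `c d`, `e f` of the unit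
circle are concurrent or parallel. -/
def concurrencyDet {R : Type*} [CommRing R] (a b c d e f : R) : R :=
  (a + b) * (e * f - c * d) - (c + d) * (e * f - a * b) + (e + f) * (c * d - a * b)

lemma concurrencyDet_eq_zero {a b c d e f p : ℂ} (h₁ : OnChord a b p) (h₂ : OnChord c d p)
    (h₃ : OnChord e f p) : concurrencyDet a b c d e f = 0 := by
  unfold OnChord concurrencyDet at *
  linear_combination -(e * f - c * d) * h₁ + (e * f - a * b) * h₂ - (c * d - a * b) * h₃

/-- Squaring is a Galois conjugation on roots of unity of odd order. -/
lemma concurrencyDet_sq_eq_zero {n : ℕ} (hn : n ≠ 0) (hodd : Odd n) {a b c d e f : ℂ}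
    (ha : a ^ n = 1) (hb : b ^ n = 1) (hc : c ^ n = 1) (hd : d ^ n = 1) (he : e ^ n = 1)
    (hf : f ^ n = 1) (h : concurrencyDet a b c d e f = 0) :
    concurrencyDet (a ^ 2) (b ^ 2) (c ^ 2) (d ^ 2) (e ^ 2) (f ^ 2) = 0 := by
  have : NeZero n := ⟨hn⟩
  have hζ := Complex.isPrimitiveRoot_exp n hn
  generalize Complex.exp (2 * Real.pi * Complex.I / n) = ζ at hζ
  obtain ⟨i, -, rfl⟩ := hζ.eq_pow_of_pow_eq_one ha
  obtain ⟨j, -, rfl⟩ := hζ.eq_pow_of_pow_eq_one hb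
  obtain ⟨k, -, rfl⟩ := hζ.eq_pow_of_pow_eq_one hc
  obtain ⟨l, -, rfl⟩ := hζ.eq_pow_of_pow_eq_one hd
  obtain ⟨m, -, rfl⟩ := hζ.eq_pow_of_pow_eq_one he
  obtain ⟨r, -, rfl⟩ := hζ.eq_pow_of_pow_eq_one hf
  let P : Polynomial ℤ := concurrencyDet (Polynomial.X ^ i) (Polynomial.X ^ j) (Polynomial.X ^ k)
    (Polynomial.X ^ l) (Polynomial.X ^ m) (Polynomial.X ^ r)
  have hP (x : ℂ) : Polynomial.aeval x P =
      concurrencyDet (x ^ i) (x ^ j) (x ^ k) (x ^ l) (x ^ m) (x ^ r) := by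
    simp [P, concurrencyDet]
  have hdvd : minpoly ℤ ζ ∣ P :=
    minpoly.isIntegrallyClosed_dvd (hζ.isIntegral (Nat.pos_of_ne_zero hn)) (by rw [hP, h])
  rw [hζ.minpoly_eq_pow_coprime hodd.coprime_two_left] at hdvd
  have h2 := hP (ζ ^ 2)
  rw [Polynomial.aeval_eq_zero_of_dvd_aeval_eq_zero hdvd (minpoly.aeval ℤ _)] at h2
  simpa only [pow_right_comm ζ _ 2] using h2.symm

/-- Three chords of an odd regular polygon with six distinct endpoints do not meet in the open
unit disc. -/
lemma not_three_onChord {n : ℕ} (hn : n ≠ 0) (hodd : Odd n) {a b c d e f p : ℂ}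
    (ha : a ^ n = 1) (hb : b ^ n = 1) (hc : c ^ n = 1) (hd : d ^ n = 1) (he : e ^ n = 1)
    (hf : f ^ n = 1) (h₁ : OnChord a b p) (h₂ : OnChord c d p) (h₃ : OnChord e f p)
    (hac : a ≠ c) (had : a ≠ d) (hae : a ≠ e) (hbe : b ≠ e) (hcf : c ≠ f) (hdf : d ≠ f) :
    False := by
  have hD := concurrencyDet_eq_zero h₁ h₂ h₃
  have hD2 := concurrencyDet_sq_eq_zero hn hodd ha hb hc hd he hf hD
  unfold concurrencyDet at hD hD2
  have hA : (a - c) * (e - b) * (d - f) ≠ 0 :=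
    mul_ne_zero (mul_ne_zero (sub_ne_zero.2 hac) (sub_ne_zero.2 hbe.symm)) (sub_ne_zero.2 hdf)
  have hAB : (a - c) * (e - b) * (d - f) + (c - e) * (b - d) * (f - a) = 0 := by
    linear_combination -hD
  have hcos : (a + c) * (e + b) * (d + f) = (c + e) * (b + d) * (f + a) := by
    refine mul_left_cancel₀ hA ?_
    linear_combination -hD2 - (c + e) * (b + d) * (f + a) * hAB
  have h1 : a * b * f + c * e * f + c * b * d = a * c * b + c * d * f + e * b * f := by
    linear_combination (hcos + hAB) / 2
  have h2 : a * c * d + a * e * b + e * d * f = a * e * f + a * b * d + c * e * d := by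
    linear_combination (hAB - hcos) / 2
  have key : a * (f - c) * (a * b - c * d) * (a - e) = 0 := by
    linear_combination a ^ 2 * h1 + a * c * h2
  have ha0 : a ≠ 0 := by
    rintro rfl
    simp [hn] at ha
  have := h₁.mul_ne_mul h₂ hac had
  simp [sub_eq_zero, ha0, this, hae, hcf.symm] at key

/-- Three distinct points of the unit circle are affinely independent. -/
lemma coeff_eq_zero_of_norm_eq_one {a b c : ℂ} (ha : ‖a‖ = 1) (hb : ‖b‖ = 1) (hc : ‖c‖ = 1)
    (hab : a ≠ b) (hac : a ≠ c) {α β γ : ℝ} (hsum : α + β + γ = 0)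
    (h : α • a + β • b + γ • c = 0) : α = 0 := by
  have h' := congrArg conj h
  simp only [Complex.real_smul, map_add, map_mul, Complex.conj_ofReal, map_zero] at h h'
  have hs : (α : ℂ) + β + γ = 0 := by exact_mod_cast hsum
  have h1 := mul_conj_of_norm_eq_one ha
  have h2 := mul_conj_of_norm_eq_one hb
  have h3 := mul_conj_of_norm_eq_one hc
  have key : (α : ℂ) * ((a - b) * (a - c)) = 0 := by
    linear_combination a * h + a * b * c * h' - a * (b + c) * hs
      - (α * b * c) * h1 - (β * a * c) * h2 - (γ * a * b) * h3
  simpa [sub_eq_zero, hab, hac] using key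

lemma re_mul_conj_lt_one {a b : ℂ} (ha : ‖a‖ = 1) (hb : ‖b‖ = 1) (hab : a ≠ b) :
    (b * conj a).re < 1 := by
  have h : 0 < Complex.normSq (b - a) := Complex.normSq_pos.2 (sub_ne_zero.2 hab.symm)
  rw [Complex.normSq_sub, Complex.normSq_eq_norm_sq, Complex.normSq_eq_norm_sq, ha, hb] at h
  linarith

lemma CrossAt.swap {a b c d p : ℂ} (h : CrossAt a b c d p) : CrossAt c d a b p := ⟨h.2, h.1⟩

lemma CrossAt.swap_left {a b c d p : ℂ} (h : CrossAt a b c d p) : CrossAt b a c d p :=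
  ⟨openSegment_symm ℝ a b ▸ h.1, h.2⟩

lemma CrossAt.swap_right {a b c d p : ℂ} (h : CrossAt a b c d p) : CrossAt a b d c p :=
  h.swap.swap_left.swap

/-- No point of the unit circle is a convex combination of three others. -/
lemma not_convex_combination {a b c d : ℂ} (ha : ‖a‖ = 1) (hb : ‖b‖ = 1) (hc : ‖c‖ = 1)
    (hd : ‖d‖ = 1) (hab : a ≠ b) (hac : a ≠ c) (had : a ≠ d) {α β γ δ : ℝ}
    (hsum : α + β + γ + δ = 0) (h : α • a + β • b + γ • c + δ • d = 0)
    (hβ : β < 0) (hγ : γ < 0) (hδ : δ < 0) : False := by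
  have h' := congrArg (fun z : ℂ => (z * conj a).re) h
  simp only [Complex.real_smul, add_mul, mul_assoc, Complex.add_re, Complex.re_ofReal_mul,
    mul_conj_of_norm_eq_one ha, zero_mul, Complex.zero_re, Complex.one_re] at h'
  nlinarith [re_mul_conj_lt_one ha hb hab, re_mul_conj_lt_one ha hc hac,
    re_mul_conj_lt_one ha hd had]

lemma exists_crossAt_of_signs {a b c d : ℂ} {α β γ δ : ℝ}
    (hsum : α + β + γ + δ = 0) (h : α • a + β • b + γ • c + δ • d = 0)
    (hα : 0 < α) (hβ : 0 < β) (hγ : γ < 0) (hδ : δ < 0) : ∃ p, CrossAt a b c d p := by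
  have hs : 0 < α + β := add_pos hα hβ
  refine ⟨(α / (α + β)) • a + (β / (α + β)) • b,
    ⟨_, _, div_pos hα hs, div_pos hβ hs, by field_simp, rfl⟩,
    ⟨-γ / (α + β), -δ / (α + β), div_pos (neg_pos.2 hγ) hs, div_pos (neg_pos.2 hδ) hs, ?_, ?_⟩⟩
  · field_simp; linarith
  · have hs' : (α : ℂ) + β ≠ 0 := by exact_mod_cast hs.ne'
    simp only [Complex.real_smul] at h ⊢
    push_cast
    field_simp
    linear_combination -h

lemma coeffs_eq_zero_of_coeff_eq_zero {a b c d : ℂ} (hb : ‖b‖ = 1) (hc : ‖c‖ = 1)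
    (hd : ‖d‖ = 1) (hbc : b ≠ c) (hbd : b ≠ d) (hcd : c ≠ d) {α β γ δ : ℝ}
    (hsum : α + β + γ + δ = 0) (h : α • a + β • b + γ • c + δ • d = 0) (hα : α = 0) :
    β = 0 ∧ γ = 0 ∧ δ = 0 := by
  subst hα
  rw [zero_smul, zero_add] at h
  rw [zero_add] at hsum
  exact ⟨coeff_eq_zero_of_norm_eq_one hb hc hd hbc hbd hsum h,
    coeff_eq_zero_of_norm_eq_one (α := γ) (β := β) (γ := δ) hc hb hd hbc.symm hcd (by linarith)
      (by rw [← h]; abel),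
    coeff_eq_zero_of_norm_eq_one (α := δ) (β := β) (γ := γ) hd hb hc hbd.symm hcd.symm
      (by linarith) (by rw [← h]; abel)⟩

lemma exists_crossAt_of_coeff_pos {a b c d : ℂ} (ha : ‖a‖ = 1) (hb : ‖b‖ = 1) (hc : ‖c‖ = 1)
    (hd : ‖d‖ = 1) (hab : a ≠ b) (hac : a ≠ c) (had : a ≠ d) (hbc : b ≠ c) (hbd : b ≠ d)
    (hcd : c ≠ d) {α β γ δ : ℝ} (hsum : α + β + γ + δ = 0)
    (h : α • a + β • b + γ • c + δ • d = 0) (hα : 0 < α) (hβ : β ≠ 0) (hγ : γ ≠ 0)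
    (hδ : δ ≠ 0) :
    ∃ p, CrossAt a b c d p ∨ CrossAt a c b d p ∨ CrossAt a d b c p := by
  have hneg : (-α) • a + (-β) • b + (-γ) • c + (-δ) • d = 0 := by
    rw [← neg_zero, ← h]; module
  rcases hβ.lt_or_gt with hβ | hβ <;> rcases hγ.lt_or_gt with hγ | hγ <;>
    rcases hδ.lt_or_gt with hδ | hδ
  · exact (not_convex_combination ha hb hc hd hab hac had hsum h hβ hγ hδ).elim
  · obtain ⟨p, hp⟩ := exists_crossAt_of_signs (a := a) (b := d) (c := b) (d := c)
      (by linarith) (by rw [← h]; abel) hα hδ hβ hγ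
    exact ⟨p, .inr (.inr hp)⟩
  · obtain ⟨p, hp⟩ := exists_crossAt_of_signs (a := a) (b := c) (c := b) (d := d)
      (by linarith) (by rw [← h]; abel) hα hγ hβ hδ
    exact ⟨p, .inr (.inl hp)⟩
  · exact (not_convex_combination (α := -β) (β := -α) (γ := -γ) (δ := -δ) hb ha hc hd hab.symm
      hbc hbd (by linarith) (by rw [← hneg]; abel) (by linarith) (by linarith)
      (by linarith)).elim
  · obtain ⟨p, hp⟩ := exists_crossAt_of_signs hsum h hα hβ hγ hδ
    exact ⟨p, .inl hp⟩
  · exact (not_convex_combination (α := -γ) (β := -α) (γ := -β) (δ := -δ) hc ha hb hd hac.symm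
      hbc.symm hcd (by linarith) (by rw [← hneg]; abel) (by linarith) (by linarith)
      (by linarith)).elim
  · exact (not_convex_combination (α := -δ) (β := -α) (γ := -β) (δ := -γ) hd ha hb hc had.symm
      hbd.symm hcd.symm (by linarith) (by rw [← hneg]; abel) (by linarith) (by linarith)
      (by linarith)).elim
  · linarith

/-- Among four points of the unit circle, some two of the chords joining them in pairs cross. -/
lemma exists_crossAt {a b c d : ℂ} (ha : ‖a‖ = 1) (hb : ‖b‖ = 1) (hc : ‖c‖ = 1)
    (hd : ‖d‖ = 1) (hab : a ≠ b) (hac : a ≠ c) (had : a ≠ d) (hbc : b ≠ c) (hbd : b ≠ d)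
    (hcd : c ≠ d) :
    ∃ p, CrossAt a b c d p ∨ CrossAt a c b d p ∨ CrossAt a d b c p := by
  obtain ⟨w, hw, hsum, x, hx, hx0⟩ :=
    Module.exists_nontrivial_relation_sum_zero_of_finrank_succ_lt_card (R := ℝ)
      (t := ({a, b, c, d} : Finset ℂ)) (by
        rw [Complex.finrank_real_complex]
        simp [Finset.card_insert_of_notMem, *])
  rw [Finset.sum_insert (by simp [*]), Finset.sum_insert (by simp [*]),
    Finset.sum_insert (by simp [*]), Finset.sum_singleton, ← add_assoc, ← add_assoc] at hw hsum
  simp only [Finset.mem_insert, Finset.mem_singleton] at hx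
  have hα : w a ≠ 0 := fun h0 => by
    obtain ⟨h1, h2, h3⟩ := coeffs_eq_zero_of_coeff_eq_zero hb hc hd hbc hbd hcd hsum hw h0
    rcases hx with rfl | rfl | rfl | rfl <;> contradiction
  have hβ : w b ≠ 0 := fun h0 => hα (coeffs_eq_zero_of_coeff_eq_zero (α := w b) (β := w a)
    (γ := w c) (δ := w d) ha hc hd hac had hcd (by linarith) (by rw [← hw]; abel) h0).1
  have hγ : w c ≠ 0 := fun h0 => hα (coeffs_eq_zero_of_coeff_eq_zero (α := w c) (β := w a)
    (γ := w b) (δ := w d) ha hb hd hab had hbd (by linarith) (by rw [← hw]; abel) h0).1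
  have hδ : w d ≠ 0 := fun h0 => hα (coeffs_eq_zero_of_coeff_eq_zero (α := w d) (β := w a)
    (γ := w b) (δ := w c) ha hb hc hab hac hbc (by linarith) (by rw [← hw]; abel) h0).1
  rcases hα.lt_or_gt with hα | hα
  · exact exists_crossAt_of_coeff_pos (α := -w a) (β := -w b) (γ := -w c) (δ := -w d)
      ha hb hc hd hab hac had hbc hbd hcd (by linarith)
      (by rw [← neg_zero, ← hw]; module) (neg_pos.2 hα) (neg_ne_zero.2 hβ) (neg_ne_zero.2 hγ)
      (neg_ne_zero.2 hδ)
  · exact exists_crossAt_of_coeff_pos ha hb hc hd hab hac had hbc hbd hcd hsum hw hα hβ hγ hδ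

/-- The pairing of four points of the unit circle into crossing chords is unique. -/
lemma CrossAt.not_crossAt {a b c d p q : ℂ} (hb : ‖b‖ = 1) (hc : ‖c‖ = 1)
    (hd : ‖d‖ = 1) (hbc : b ≠ c) (hbd : b ≠ d) (h₁ : CrossAt a b c d p) :
    ¬ CrossAt a c b d q := by
  rintro ⟨⟨u, u', hu, hu', huu, rfl⟩, ⟨v, v', hv, hv', hvv, hq⟩⟩
  obtain ⟨⟨t, t', ht, ht', htt, rfl⟩, ⟨s, s', hs, hs', hss, hp⟩⟩ := h₁
  have := coeff_eq_zero_of_norm_eq_one hb hc hd hbc hbd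
    (α := u * t' + t * v) (β := -(u * s) - t * u') (γ := t * v' - u * s')
    (by linear_combination u * htt - u * hss + t * hvv - t * huu) (by
      simp only [Complex.real_smul] at *
      push_cast
      linear_combination t * hq - u * hp)
  nlinarith [mul_pos hu ht', mul_pos ht hv]

lemma CrossAt.unique {a b c d p q : ℂ} (ha : ‖a‖ = 1) (hb : ‖b‖ = 1) (hc : ‖c‖ = 1)
    (hd : ‖d‖ = 1) (hac : a ≠ c) (had : a ≠ d) (h₁ : CrossAt a b c d p)
    (h₂ : CrossAt a b c d q) : p = q := by
  have e₁ := onChord_of_mem_segment ha hb (openSegment_subset_segment _ _ _ h₁.1)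
  have e₂ := onChord_of_mem_segment hc hd (openSegment_subset_segment _ _ _ h₁.2)
  have e₃ := onChord_of_mem_segment ha hb (openSegment_subset_segment _ _ _ h₂.1)
  have e₄ := onChord_of_mem_segment hc hd (openSegment_subset_segment _ _ _ h₂.2)
  have hne := e₁.mul_ne_mul e₂ hac had
  unfold OnChord at *
  have : (a * b - c * d) * (conj p - conj q) = 0 := by linear_combination e₁ - e₂ - e₃ + e₄
  rcases mul_eq_zero.1 this with h | h
  · exact absurd (sub_eq_zero.1 h) hne
  · exact (starRingEnd ℂ).injective (sub_eq_zero.1 h)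

lemma ne_of_card_eq_four {α : Type*} [DecidableEq α] {a b c d : α}
    (h : ({a, b, c, d} : Finset α).card = 4) :
    a ≠ b ∧ a ≠ c ∧ a ≠ d ∧ b ≠ c ∧ b ≠ d ∧ c ≠ d := by
  have key (x y z : α) : ({a, b, c, d} : Finset α) ≠ {x, y, z} := fun h' => by
    have := Finset.card_le_three (a := x) (b := y) (c := z)
    rw [← h', h] at this
    omega
  refine ⟨?_, ?_, ?_, ?_, ?_, ?_⟩ <;> rintro rfl
  · exact key a c d (by simp)
  · exact key a b d (by ext; simp; tauto)
  · exact key a b c (by ext; simp; tauto)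
  · exact key a b d (by simp)
  · exact key a b c (by ext; simp; tauto)
  · exact key a b c (by simp)

/-- The crossing point is determined by the set of the four endpoints. -/
lemma CrossAt.eq_of_insert_eq {a b c d a' b' c' d' p q : ℂ} (ha : ‖a‖ = 1) (hb : ‖b‖ = 1)
    (hc : ‖c‖ = 1) (hd : ‖d‖ = 1) (hcard : ({a, b, c, d} : Finset ℂ).card = 4)
    (hS : ({a', b', c', d'} : Finset ℂ) = {a, b, c, d}) (h₁ : CrossAt a b c d p)
    (h₂ : CrossAt a' b' c' d' q) : p = q := by
  obtain ⟨hab, hac, had, hbc, hbd, hcd⟩ := ne_of_card_eq_four hcard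
  obtain ⟨hab', hac', had', hbc', hbd', hcd'⟩ := ne_of_card_eq_four (hS ▸ hcard)
  -- the three possible pairings, with the common vertex `a` first
  have huniq : CrossAt a b c d q → p = q := h₁.unique ha hb hc hd hac had
  have hno₁ : ¬ CrossAt a c b d q := h₁.not_crossAt hb hc hd hbc hbd
  have hno₂ : ¬ CrossAt a d b c q := h₁.swap_right.not_crossAt hb hd hc hbd hbc
  have hmem (x : ℂ) (hx : x ∈ ({a', b', c', d'} : Finset ℂ)) : x = a ∨ x = b ∨ x = c ∨ x = d := by
    simpa [hS] using hx
  have e₁ := hmem a' (by simp)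
  have e₂ := hmem b' (by simp)
  have e₃ := hmem c' (by simp)
  have e₄ := hmem d' (by simp)
  clear hmem hS hcard
  have s₁ {x y z w : ℂ} : CrossAt x y z w q → CrossAt z w x y q := CrossAt.swap
  have s₂ {x y z w : ℂ} : CrossAt x y z w q → CrossAt y x z w q := CrossAt.swap_left
  have s₃ {x y z w : ℂ} : CrossAt x y z w q → CrossAt x y w z q := CrossAt.swap_right
  rcases e₁ with rfl | rfl | rfl | rfl <;> rcases e₂ with rfl | rfl | rfl | rfl <;>
    first
    | exact absurd rfl hab'
    | (rcases e₃ with rfl | rfl | rfl | rfl <;>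
        first
        | exact absurd rfl hac'
        | exact absurd rfl hbc'
        | (rcases e₄ with rfl | rfl | rfl | rfl <;>
            first
            | exact absurd rfl had'
            | exact absurd rfl hbd'
            | exact absurd rfl hcd'
            | grind))

lemma norm_lt_one_of_mem_openSegment {a b p : ℂ} (ha : ‖a‖ = 1) (hb : ‖b‖ = 1) (hab : a ≠ b)
    (hp : p ∈ openSegment ℝ a b) : ‖p‖ < 1 := by
  obtain ⟨s, t, hs, ht, hst, rfl⟩ := hp
  exact norm_combo_lt_of_ne ha.le hb.le hab hs ht hst

lemma CrossAt.mem_interior_convexHull {a b c d p : ℂ} (ha : ‖a‖ = 1) (hb : ‖b‖ = 1)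
    (hd : ‖d‖ = 1) (hab : a ≠ b) (had : a ≠ d) (hbd : b ≠ d) (h : CrossAt a b c d p) :
    p ∈ interior (convexHull ℝ {a, b, c, d}) := by
  have hind : AffineIndependent ℝ ![a, b, d] := by
    refine EuclideanGeometry.Cospherical.affineIndependent_of_ne ⟨0, 1, ?_⟩ hab had hbd
    simp [ha, hb, hd]
  let B : AffineBasis (Fin 3) ℝ ℂ := ⟨_, hind, by
    rw [hind.affineSpan_eq_top_iff_card_eq_finrank_add_one, Complex.finrank_real_complex]
    simp⟩
  have hq : AffineMap.lineMap p d (1 / 2 : ℝ) ∈ interior (convexHull ℝ {a, b, c, d}) := by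
    have hsub : Set.range B ⊆ {a, b, c, d} := by
      rintro _ ⟨i, rfl⟩
      fin_cases i
      exacts [.inl rfl, .inr (.inl rfl), .inr (.inr (.inr rfl))]
    refine interior_mono (convexHull_mono hsub) ?_
    rw [B.interior_convexHull]
    obtain ⟨⟨s, t, hs, ht, hst, rfl⟩, -⟩ := h
    obtain rfl : s = 1 - t := by linarith
    rw [← AffineMap.lineMap_apply_module]
    intro i
    have h0 : B.coord i a = if i = 0 then 1 else 0 := B.coord_apply i 0
    have h1 : B.coord i b = if i = 1 then 1 else 0 := B.coord_apply i 1
    have h2 : B.coord i d = if i = 2 then 1 else 0 := B.coord_apply i 2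
    rw [AffineMap.apply_lineMap, AffineMap.apply_lineMap, h0, h1, h2,
      AffineMap.lineMap_apply_ring, AffineMap.lineMap_apply_ring]
    fin_cases i <;> simp <;> linarith
  refine (convex_convexHull ℝ _).openSegment_interior_self_subset_interior hq
    (subset_convexHull ℝ _ (show c ∈ {a, b, c, d} by simp)) ?_
  obtain ⟨-, s, t, hs, ht, hst, rfl⟩ := h
  refine ⟨2 * t / (1 + t), s / (1 + t), by positivity, by positivity, ?_, ?_⟩
  · field_simp; linarith
  · have ht' : (1 : ℂ) + t ≠ 0 := by exact_mod_cast (by positivity : (1 : ℝ) + t ≠ 0)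
    simp only [AffineMap.lineMap_apply_module, Complex.real_smul]
    push_cast
    field_simp
    ring

lemma interior_ngon_subset_ball {n : ℕ} (hn : n ≠ 0) : interior (Ngon n) ⊆ Metric.ball 0 1 := by
  rw [← interior_closedBall (0 : ℂ) one_ne_zero]
  refine interior_mono (convexHull_min (fun z hz => ?_) (convex_closedBall _ _))
  simpa using (norm_eq_one_of_pow_eq_one hz hn).le

/-- The line through two adjacent vertices of the regular `n`-gon has all other vertices strictly on
the same side. -/
lemma re_mul_conj_lt_cos {n : ℕ} (hn : n ≠ 0) {a c : ℂ} (ha : a ^ n = 1) (hc : c ^ n = 1)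
    (hac : c ≠ a) (hac' : c ≠ a * Complex.exp (2 * Real.pi * Complex.I / n)) :
    (c * conj (a * Complex.exp ((Real.pi / n : ℝ) * Complex.I))).re < Real.cos (Real.pi / n) := by
  have : NeZero n := ⟨hn⟩
  have ha1 := mul_conj_of_norm_eq_one (Complex.norm_eq_one_of_pow_eq_one ha hn)
  have ha0 : a ≠ 0 := left_ne_zero_of_mul_eq_one ha1
  have hn0 : (0 : ℝ) < n := by positivity
  obtain ⟨k, hk, hck⟩ := (Complex.isPrimitiveRoot_exp n hn).eq_pow_of_pow_eq_one
    (show (c / a) ^ n = 1 by rw [div_pow, hc, ha, div_one])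
  rw [eq_div_iff ha0] at hck
  have hk0 : k ≠ 0 := by rintro rfl; simp [hac.symm] at hck
  have hk1 : k ≠ 1 := by rintro rfl; exact hac' (by rw [← hck, pow_one, mul_comm])
  have hk2 : (2 : ℝ) ≤ k := by exact_mod_cast (by omega : 2 ≤ k)
  have hkn : (k : ℝ) + 1 ≤ n := by exact_mod_cast hk
  have harg : c * conj (a * Complex.exp ((Real.pi / n : ℝ) * Complex.I)) =
      Complex.exp (((2 * k - 1) * (Real.pi / n) : ℝ) * Complex.I) := by
    rw [← hck, map_mul, ← Complex.exp_conj, map_mul, Complex.conj_ofReal, Complex.conj_I,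
      ← Complex.exp_nat_mul, mul_assoc, ← mul_assoc a, ha1, one_mul, ← Complex.exp_add]
    congr 1
    push_cast
    ring
  rw [harg, Complex.exp_ofReal_mul_I_re]
  set x := Real.pi / n with hx
  have hx0 : 0 < x := by positivity
  have hxn : n * x = Real.pi := by rw [hx]; field_simp
  rcases le_total ((2 * k - 1) * x) Real.pi with h | h
  · exact Real.cos_lt_cos_of_nonneg_of_le_pi hx0.le h (by nlinarith)
  · rw [← Real.cos_two_pi_sub ((2 * k - 1) * x)]
    exact Real.cos_lt_cos_of_nonneg_of_le_pi hx0.le (by linarith) (by nlinarith)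

/-- A crossing chord of the regular `n`-gon is not a side. -/
lemma CrossAt.ne_mul_exp {n : ℕ} (hn : n ≠ 0) {a b c d p : ℂ} (ha : a ^ n = 1)
    (hc : c ^ n = 1) (hd : d ^ n = 1) (hac : a ≠ c) (had : a ≠ d) (hbc : b ≠ c)
    (hbd : b ≠ d) (h : CrossAt a b c d p) :
    b ≠ a * Complex.exp (2 * Real.pi * Complex.I / n) := by
  rintro rfl
  have h1 := re_mul_conj_lt_cos hn ha hc hac.symm hbc.symm
  have h2 := re_mul_conj_lt_cos hn ha hd had.symm hbd.symm
  have ha1 := mul_conj_of_norm_eq_one (Complex.norm_eq_one_of_pow_eq_one ha hn)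
  set ω := Complex.exp (2 * Real.pi * Complex.I / n) with hω
  set μ := Complex.exp ((Real.pi / n : ℝ) * Complex.I) with hμ
  have h3 : (a * conj (a * μ)).re = Real.cos (Real.pi / n) := by
    rw [map_mul, ← mul_assoc, ha1, one_mul, Complex.conj_re, hμ, Complex.exp_ofReal_mul_I_re]
  have h4 : (a * ω * conj (a * μ)).re = Real.cos (Real.pi / n) := by
    have hωμ : ω = μ * μ := by
      rw [hω, hμ, ← Complex.exp_add]; congr 1; push_cast; ring
    have hμ1 : μ * conj μ = 1 := mul_conj_of_norm_eq_one (Complex.norm_exp_ofReal_mul_I _)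
    have : a * ω * conj (a * μ) = μ := by
      rw [map_mul, hωμ]; linear_combination (μ * μ * conj μ) * ha1 + μ * hμ1
    rw [this, hμ, Complex.exp_ofReal_mul_I_re]
  obtain ⟨⟨s, t, -, -, hst, rfl⟩, ⟨s', t', hs', ht', hst', hp⟩⟩ := h
  have h5 := congrArg (fun z : ℂ => (z * conj (a * μ)).re) hp
  simp only [Complex.real_smul, add_mul, mul_assoc, Complex.add_re, Complex.re_ofReal_mul] at *
  rw [h3, h4, ← add_mul, hst, ← hst', add_mul] at h5
  linarith [mul_lt_mul_of_pos_left h1 hs', mul_lt_mul_of_pos_left h2 ht']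

lemma CrossAt.isDiagonal {n : ℕ} (hn : n ≠ 0) {a b c d p : ℂ} (ha : a ^ n = 1) (hb : b ^ n = 1)
    (hc : c ^ n = 1) (hd : d ^ n = 1) (hab : a ≠ b) (hac : a ≠ c) (had : a ≠ d) (hbc : b ≠ c)
    (hbd : b ≠ d) (h : CrossAt a b c d p) : IsDiagonal n (segment ℝ a b) :=
  ⟨a, b, ha, hb, hab, h.ne_mul_exp hn ha hc hd hac had hbc hbd,
    h.swap_left.ne_mul_exp hn hb hc hd hbc hbd hac had, rfl⟩

/-- At most two chords of an odd regular polygon pass through a point of the open unit disc. -/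
lemma eq_endpoints_of_onChord {n : ℕ} (hn : n ≠ 0) (hodd : Odd n) {a b c d e f p : ℂ}
    (ha : a ^ n = 1) (hb : b ^ n = 1) (hc : c ^ n = 1) (hd : d ^ n = 1) (he : e ^ n = 1)
    (hf : f ^ n = 1) (hp : ‖p‖ < 1) (h₁ : OnChord a b p) (h₂ : OnChord c d p)
    (h₃ : OnChord e f p) (hac : a ≠ c) (had : a ≠ d) :
    (e = a ∧ f = b) ∨ (e = b ∧ f = a) ∨ (e = c ∧ f = d) ∨ (e = d ∧ f = c) := by
  have hunit {x : ℂ} (hx : x ^ n = 1) := Complex.norm_eq_one_of_pow_eq_one hx hn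
  by_cases hae : a = e
  · subst hae; exact .inl ⟨rfl, h₃.right_unique (hunit ha) hp h₁⟩
  by_cases hbe : b = e
  · subst hbe; exact .inr (.inl ⟨rfl, h₃.right_unique (hunit hb) hp h₁.symm⟩)
  by_cases hcf : c = f
  · subst hcf; exact .inr (.inr (.inr ⟨h₃.symm.right_unique (hunit hc) hp h₂, rfl⟩))
  by_cases hdf : d = f
  · subst hdf; exact .inr (.inr (.inl ⟨h₃.symm.right_unique (hunit hd) hp h₂.symm, rfl⟩))
  exact (not_three_onChord hn hodd ha hb hc hd he hf h₁ h₂ h₃ hac had hae hbe hcf hdf).elim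

lemma ne_of_segment_ne {a b c d p : ℂ} (ha : ‖a‖ = 1) (hp : ‖p‖ < 1) (h₁ : OnChord a b p)
    (h₂ : OnChord c d p) (h : segment ℝ a b ≠ segment ℝ c d) : a ≠ c ∧ a ≠ d := by
  constructor
  · rintro rfl
    exact h (by rw [h₁.right_unique ha hp h₂])
  · rintro rfl
    exact h (by rw [h₁.right_unique ha hp h₂.symm, segment_symm])

/-- `S` consists of the endpoints of two chords crossing at `p`. -/
def IsCrossing (S : Finset ℂ) (p : ℂ) : Prop :=
  ∃ a b c d : ℂ, S = {a, b, c, d} ∧ CrossAt a b c d p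

lemma IsCrossing.point_unique {S : Finset ℂ} (hS : ∀ z ∈ S, ‖z‖ = 1) (hcard : S.card = 4)
    {p q : ℂ} (hp : IsCrossing S p) (hq : IsCrossing S q) : p = q := by
  obtain ⟨a, b, c, d, rfl, h⟩ := hp
  obtain ⟨a', b', c', d', hS', h'⟩ := hq
  exact h.eq_of_insert_eq (hS a (by simp)) (hS b (by simp)) (hS c (by simp)) (hS d (by simp))
    hcard hS'.symm h'

lemma exists_isCrossing {S : Finset ℂ} (hS : ∀ z ∈ S, ‖z‖ = 1) (hcard : S.card = 4) :
    ∃ p, IsCrossing S p := by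
  obtain ⟨a, T, -, rfl, hT⟩ := Finset.card_eq_succ.1 hcard
  obtain ⟨b, c, d, -, -, -, rfl⟩ := Finset.card_eq_three.1 hT
  obtain ⟨hab, hac, had, hbc, hbd, hcd⟩ := ne_of_card_eq_four hcard
  obtain ⟨p, hp | hp | hp⟩ := exists_crossAt (hS a (by simp)) (hS b (by simp)) (hS c (by simp))
    (hS d (by simp)) hab hac had hbc hbd hcd
  · exact ⟨p, a, b, c, d, rfl, hp⟩
  · exact ⟨p, a, c, b, d, by ext; simp; tauto, hp⟩
  · exact ⟨p, a, d, b, c, by ext; simp; tauto, hp⟩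

lemma IsCrossing.endpoints_subset {n : ℕ} (hn : n ≠ 0) (hodd : Odd n) {S T : Finset ℂ} {p : ℂ}
    (hS : ∀ z ∈ S, z ^ n = 1) (hT : ∀ z ∈ T, z ^ n = 1) (hcard : S.card = 4)
    (hSp : IsCrossing S p) (hTp : IsCrossing T p) : T ⊆ S := by
  have hunit {x : ℂ} (hx : x ^ n = 1) := Complex.norm_eq_one_of_pow_eq_one hx hn
  obtain ⟨a, b, c, d, rfl, h⟩ := hSp
  obtain ⟨a', b', c', d', rfl, h'⟩ := hTp
  simp only [Finset.mem_insert, Finset.mem_singleton, forall_eq_or_imp, forall_eq] at hS hT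
  obtain ⟨ha, hb, hc, hd⟩ := hS
  obtain ⟨ha', hb', hc', hd'⟩ := hT
  obtain ⟨hab, hac, had, -⟩ := ne_of_card_eq_four hcard
  have hp := norm_lt_one_of_mem_openSegment (hunit ha) (hunit hb) hab h.1
  have chord {x y : ℂ} (hx : x ^ n = 1) (hy : y ^ n = 1) (h : p ∈ openSegment ℝ x y) :=
    onChord_of_mem_segment (hunit hx) (hunit hy) (openSegment_subset_segment _ _ _ h)
  have e₁ := eq_endpoints_of_onChord hn hodd ha hb hc hd ha' hb' hp (chord ha hb h.1)
    (chord hc hd h.2) (chord ha' hb' h'.1) hac had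
  have e₂ := eq_endpoints_of_onChord hn hodd ha hb hc hd hc' hd' hp (chord ha hb h.1)
    (chord hc hd h.2) (chord hc' hd' h'.2) hac had
  intro z
  simp only [Finset.mem_insert, Finset.mem_singleton]
  grind

lemma IsCrossing.mem_interior_ngon {n : ℕ} (hn : n ≠ 0) {S : Finset ℂ} (hS : ∀ z ∈ S, z ^ n = 1)
    (hcard : S.card = 4) {p : ℂ} (h : IsCrossing S p) : p ∈ interior (Ngon n) := by
  have hunit {x : ℂ} (hx : x ^ n = 1) := Complex.norm_eq_one_of_pow_eq_one hx hn
  obtain ⟨a, b, c, d, rfl, h⟩ := h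
  obtain ⟨hab, -, had, -, hbd, -⟩ := ne_of_card_eq_four hcard
  refine interior_mono (convexHull_mono ?_) (h.mem_interior_convexHull (hunit (hS a (by simp)))
    (hunit (hS b (by simp))) (hunit (hS d (by simp))) hab had hbd)
  intro z hz
  exact hS z (by simpa using hz)

lemma IsCrossing.exists_isDiagonal {n : ℕ} (hn : n ≠ 0) {S : Finset ℂ}
    (hS : ∀ z ∈ S, z ^ n = 1) (hcard : S.card = 4) {p : ℂ} (h : IsCrossing S p) :
    ∃ d₁ d₂ : Set ℂ, IsDiagonal n d₁ ∧ IsDiagonal n d₂ ∧ d₁ ≠ d₂ ∧ p ∈ d₁ ∧ p ∈ d₂ := by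
  have hunit {x : ℂ} (hx : x ^ n = 1) := Complex.norm_eq_one_of_pow_eq_one hx hn
  obtain ⟨a, b, c, d, rfl, h⟩ := h
  obtain ⟨hab, hac, had, hbc, hbd, hcd⟩ := ne_of_card_eq_four hcard
  simp only [Finset.mem_insert, Finset.mem_singleton, forall_eq_or_imp, forall_eq] at hS
  obtain ⟨ha, hb, hc, hd⟩ := hS
  refine ⟨_, _, h.isDiagonal hn ha hb hc hd hab hac had hbc hbd,
    h.swap.isDiagonal hn hc hd ha hb hcd hac.symm hbc.symm had.symm hbd.symm, fun heq => ?_,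
    openSegment_subset_segment _ _ _ h.1, openSegment_subset_segment _ _ _ h.2⟩
  have ha_mem := left_mem_segment ℝ a b
  rw [heq] at ha_mem
  have := norm_lt_one_of_mem_openSegment (hunit hc) (hunit hd) hcd
    (mem_openSegment_of_ne_left_right hac.symm had.symm ha_mem)
  exact this.ne (hunit ha)

lemma exists_isCrossing_of_isDiagonal {n : ℕ} (hn : n ≠ 0) {p : ℂ} (hp : ‖p‖ < 1)
    {d₁ d₂ : Set ℂ} (h₁ : IsDiagonal n d₁) (h₂ : IsDiagonal n d₂) (hne : d₁ ≠ d₂)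
    (hp₁ : p ∈ d₁) (hp₂ : p ∈ d₂) :
    ∃ S : Finset ℂ, (∀ z ∈ S, z ^ n = 1) ∧ S.card = 4 ∧ IsCrossing S p := by
  have hunit {x : ℂ} (hx : x ^ n = 1) := Complex.norm_eq_one_of_pow_eq_one hx hn
  obtain ⟨a, b, ha, hb, hab, -, -, rfl⟩ := h₁
  obtain ⟨c, d, hc, hd, hcd, -, -, rfl⟩ := h₂
  have e₁ := onChord_of_mem_segment (hunit ha) (hunit hb) hp₁
  have e₂ := onChord_of_mem_segment (hunit hc) (hunit hd) hp₂
  obtain ⟨hac, had⟩ := ne_of_segment_ne (hunit ha) hp e₁ e₂ hne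
  obtain ⟨hbc, hbd⟩ := ne_of_segment_ne (hunit hb) hp e₁.symm e₂ (by rwa [segment_symm])
  have hnp {x : ℂ} (hx : x ^ n = 1) : x ≠ p := by
    rintro rfl
    exact hp.ne (hunit hx)
  refine ⟨{a, b, c, d}, by simp [*], by simp [Finset.card_insert_of_notMem, *], a, b, c, d, rfl,
    mem_openSegment_of_ne_left_right (hnp ha) (hnp hb) hp₁,
    mem_openSegment_of_ne_left_right (hnp hc) (hnp hd) hp₂⟩

theorem odd_ngon_no_three_diagonals_meet (n : ℕ) (hn : 3 ≤ n) (hodd : Odd n) :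
    (∀ p ∈ interior (Ngon n),
      ¬ ∃ d₁ d₂ d₃ : Set ℂ, IsDiagonal n d₁ ∧ IsDiagonal n d₂ ∧ IsDiagonal n d₃ ∧
        d₁ ≠ d₂ ∧ d₁ ≠ d₃ ∧ d₂ ≠ d₃ ∧ p ∈ d₁ ∧ p ∈ d₂ ∧ p ∈ d₃) ∧
    numIntersections n = n.choose 4 := by
  have hn0 : n ≠ 0 := by omega
  have hunit {x : ℂ} (hx : x ^ n = 1) := Complex.norm_eq_one_of_pow_eq_one hx hn0
  have hball {p : ℂ} (hp : p ∈ interior (Ngon n)) : ‖p‖ < 1 := by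
    simpa using interior_ngon_subset_ball hn0 hp
  constructor
  · rintro p hp ⟨_, _, _, ⟨a, b, ha, hb, -, -, -, rfl⟩, ⟨c, d, hc, hd, -, -, -, rfl⟩,
      ⟨e, f, he, hf, -, -, -, rfl⟩, h12, h13, h23, hp₁, hp₂, hp₃⟩
    have e₁ := onChord_of_mem_segment (hunit ha) (hunit hb) hp₁
    have e₂ := onChord_of_mem_segment (hunit hc) (hunit hd) hp₂
    have e₃ := onChord_of_mem_segment (hunit he) (hunit hf) hp₃
    obtain ⟨hac, had⟩ := ne_of_segment_ne (hunit ha) (hball hp) e₁ e₂ h12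
    rcases eq_endpoints_of_onChord hn0 hodd ha hb hc hd he hf (hball hp) e₁ e₂ e₃ hac had with
      ⟨rfl, rfl⟩ | ⟨rfl, rfl⟩ | ⟨rfl, rfl⟩ | ⟨rfl, rfl⟩
    · exact h13 rfl
    · exact h13 (segment_symm _ _ _)
    · exact h23 rfl
    · exact h23 (segment_symm _ _ _)
  · let T : Finset (Finset ℂ) := Finset.powersetCard 4 (Polynomial.nthRootsFinset n (1 : ℂ))
    have hT {S : Finset ℂ} : S ∈ T ↔ (∀ z ∈ S, z ^ n = 1) ∧ S.card = 4 := by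
      simp [T, Finset.mem_powersetCard, Finset.subset_iff,
        Polynomial.mem_nthRootsFinset (Nat.pos_of_ne_zero hn0)]
    have hex (S : Finset ℂ) : ∃ p, S ∈ T → IsCrossing S p := by
      by_cases hS : S ∈ T
      · obtain ⟨p, hp⟩ := exists_isCrossing (fun z hz => hunit ((hT.1 hS).1 z hz)) (hT.1 hS).2
        exact ⟨p, fun _ => hp⟩
      · exact ⟨0, fun h => absurd h hS⟩
    choose φ hφ using hex
    have himage : {p : ℂ | p ∈ interior (Ngon n) ∧ ∃ d₁ d₂ : Set ℂ, IsDiagonal n d₁ ∧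
        IsDiagonal n d₂ ∧ d₁ ≠ d₂ ∧ p ∈ d₁ ∧ p ∈ d₂} = φ '' T := by
      ext p
      constructor
      · rintro ⟨hp, d₁, d₂, h₁, h₂, hne, hp₁, hp₂⟩
        obtain ⟨S, hS, hcard, hcross⟩ :=
          exists_isCrossing_of_isDiagonal hn0 (hball hp) h₁ h₂ hne hp₁ hp₂
        have hST := hT.2 ⟨hS, hcard⟩
        exact ⟨S, hST, (hφ S hST).point_unique (fun z hz => hunit (hS z hz)) hcard hcross⟩
      · rintro ⟨S, hS, rfl⟩
        obtain ⟨hroots, hcard⟩ := hT.1 hS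
        exact ⟨(hφ S hS).mem_interior_ngon hn0 hroots hcard,
          (hφ S hS).exists_isDiagonal hn0 hroots hcard⟩
    have hinj : Set.InjOn φ T := by
      intro S hS S' hS' h
      obtain ⟨hr, hc⟩ := hT.1 hS
      obtain ⟨hr', hc'⟩ := hT.1 hS'
      have h₁ := hφ S hS
      have h₂ := hφ S' hS'
      rw [h] at h₁
      exact (h₂.endpoints_subset hn0 hodd hr' hr hc' h₁).antisymm
        (h₁.endpoints_subset hn0 hodd hr hr' hc h₂)
    rw [numIntersections, himage, hinj.ncard_image, Set.ncard_coe_finset,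
      Finset.card_powersetCard, (Complex.isPrimitiveRoot_exp n hn0).card_nthRootsFinset]
end
end

section
/- If a is a minimal relation of weight k, then there exist distinct primes p₁ < p₂ < ⋯ < p_s, all at most k, and a root of unity λ such that every element of the support of the rotation of a by λ (i.e., every λη with a(η) ≠ 0) is a (p₁p₂⋯p_s)-th root of unity. -/
noncomputable section

/-- A relation: a finitely supported function from roots of unity to `ℕ`,
not identically zero, whose weighted sum of roots of unity is zero. -/
structure ZeroRelation where
  coeff : ℂ →₀ ℕ
  mem_rootsOfUnity : ∀ z ∈ coeff.support, ∃ m : ℕ, 0 < m ∧ z ^ m = 1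
  ne_zero : coeff ≠ 0
  sum_zero : (coeff.sum fun z c => (c : ℂ) * z) = 0

/-- The weight of a relation: the sum of its coefficients. -/
def ZeroRelation.weight (a : ZeroRelation) : ℕ := a.coeff.sum fun _ c => c

/-- A relation is minimal if it has no nontrivial subrelation. -/
def ZeroRelation.IsMinimal (a : ZeroRelation) : Prop :=
  ∀ b : ℂ →₀ ℕ, (∀ z, b z ≤ a.coeff z) →
    (b.sum fun z c => (c : ℂ) * z) = 0 → b = 0 ∨ b = a.coeff

/-- A natural-number combination of `N`-th roots of unity that vanishes still vanishes after every
root is raised to a fixed power coprime to `N`. -/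
theorem sum_mul_pow_eq_zero_of_coprime {ι : Type*} (s : Finset ι) (c : ι → ℕ) (x : ι → ℂ)
    {N t : ℕ} (hN : 0 < N) (hx : ∀ i ∈ s, x i ^ N = 1) (ht : t.Coprime N)
    (h : ∑ i ∈ s, (c i : ℂ) * x i = 0) : ∑ i ∈ s, (c i : ℂ) * x i ^ t = 0 := by
  have : NeZero N := ⟨hN.ne'⟩
  have hζ := Complex.isPrimitiveRoot_exp N hN.ne'
  set ζ := Complex.exp (2 * Real.pi * Complex.I / N)
  have hexp : ∀ i, ∃ e : ℕ, i ∈ s → ζ ^ e = x i := by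
    intro i
    by_cases hi : i ∈ s
    · obtain ⟨e, -, he⟩ := hζ.eq_pow_of_pow_eq_one (hx i hi)
      exact ⟨e, fun _ => he⟩
    · exact ⟨0, fun h => absurd h hi⟩
  choose e he using hexp
  let P : Polynomial ℤ := ∑ i ∈ s, (c i : Polynomial ℤ) * Polynomial.X ^ e i
  have hP : Polynomial.aeval ζ P = 0 := by
    rw [← h]
    simp only [P, map_sum, map_mul, map_natCast, map_pow, Polynomial.aeval_X]
    exact Finset.sum_congr rfl fun i hi => by rw [he i hi]
  have hdvd : minpoly ℤ (ζ ^ t) ∣ P := by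
    rw [← hζ.minpoly_eq_pow_coprime ht]
    exact minpoly.isIntegrallyClosed_dvd (hζ.isIntegral hN) hP
  obtain ⟨Q, hQ⟩ := hdvd
  have hP' : Polynomial.aeval (ζ ^ t) P = 0 := by
    rw [hQ, map_mul, minpoly.aeval, zero_mul]
  rw [← hP']
  simp only [P, map_sum, map_mul, map_natCast, map_pow, Polynomial.aeval_X]
  exact Finset.sum_congr rfl fun i hi => by rw [← he i hi, pow_right_comm]

/-- Fourier inversion on the group of `p`-th roots of unity. -/
theorem sum_inv_pow_mul_sum_mul_pow {ι : Type*} (s : Finset ι) (f u : ι → ℂ) {p : ℕ}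
    (hp : 0 < p) (hu : ∀ i ∈ s, u i ^ p = 1) {w : ℂ} (hw : w ^ p = 1) :
    ∑ j ∈ Finset.range p, w⁻¹ ^ j * ∑ i ∈ s, f i * u i ^ j = p * ∑ i ∈ s with u i = w, f i := by
  have hw0 : w ≠ 0 := by
    rintro rfl
    simp [hp.ne'] at hw
  simp_rw [Finset.mul_sum]
  rw [Finset.sum_comm, Finset.sum_filter]
  refine Finset.sum_congr rfl fun i hi => ?_
  have hterm : ∀ j, w⁻¹ ^ j * (f i * u i ^ j) = f i * (u i * w⁻¹) ^ j := fun j => by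
    rw [mul_pow]; ring
  simp_rw [hterm, ← Finset.mul_sum]
  split_ifs with h
  · simp [h, hw0, mul_comm]
  · have hne : u i * w⁻¹ ≠ 1 := fun h1 => h ((mul_inv_eq_one₀ hw0).1 h1)
    rw [geom_sum_eq hne, mul_pow, hu i hi, inv_pow, hw]
    simp

theorem sum_filter_eq_zero_of_missing {ι : Type*} (s : Finset ι) (f u : ι → ℂ) {p : ℕ}
    (hp : 0 < p) (hu : ∀ i ∈ s, u i ^ p = 1) (j₀ : ℕ)
    (hT : ∀ j < p, j ≠ j₀ → ∑ i ∈ s, f i * u i ^ j = 0)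
    {v : ℂ} (hv : v ^ p = 1) (hvs : ∀ i ∈ s, u i ≠ v) {w : ℂ} (hw : w ^ p = 1) :
    ∑ i ∈ s with u i = w, f i = 0 := by
  have hp' : (p : ℂ) ≠ 0 := Nat.cast_ne_zero.2 hp.ne'
  have hv0 : v ≠ 0 := by
    rintro rfl
    simp [hp.ne'] at hv
  have hall : ∀ j < p, ∑ i ∈ s, f i * u i ^ j = 0 := by
    intro j hj
    by_cases hjj : j = j₀
    · have h := sum_inv_pow_mul_sum_mul_pow s f u hp hu hv
      rw [Finset.filter_eq_empty_iff.2 fun i hi => hvs i hi, Finset.sum_empty, mul_zero,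
        Finset.sum_eq_single_of_mem j (Finset.mem_range.2 hj)] at h
      · exact (mul_eq_zero.1 h).resolve_left (pow_ne_zero _ (inv_ne_zero hv0))
      · intro b hb hbj
        rw [hT b (Finset.mem_range.1 hb) (hjj ▸ hbj), mul_zero]
    · exact hT j hj hjj
  have h := sum_inv_pow_mul_sum_mul_pow s f u hp hu hw
  rw [Finset.sum_eq_zero fun j hj => by rw [hall j (Finset.mem_range.1 hj), mul_zero]] at h
  exact (mul_eq_zero.1 h.symm).resolve_left hp'

/-- A vanishing sum of `p * M`-th roots of unity splits along the cosets of the `M`-th roots of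
unity, provided `p ∣ M` or the sum has fewer than `p` terms. -/
theorem sum_filter_pow_eq_zero {ι : Type*} (s : Finset ι) (c : ι → ℕ) (x : ι → ℂ) {p M : ℕ}
    (hp : p.Prime) (hM : 0 < M) (hx : ∀ i ∈ s, x i ^ (p * M) = 1)
    (h : ∑ i ∈ s, (c i : ℂ) * x i = 0) (hpM : p ∣ M ∨ s.card < p) {w : ℂ} (hw : w ^ p = 1) :
    ∑ i ∈ s with x i ^ M = w, (c i : ℂ) * x i = 0 := by
  have hu : ∀ i ∈ s, (x i ^ M) ^ p = 1 := fun i hi => by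
    rw [← pow_mul, mul_comm M p]; exact hx i hi
  have hT : ∀ j, ¬ p ∣ 1 + M * j → ∑ i ∈ s, ((c i : ℂ) * x i) * (x i ^ M) ^ j = 0 := by
    intro j hj
    have hcop : (1 + M * j).Coprime (p * M) := by
      refine Nat.Coprime.mul_right ((hp.coprime_iff_not_dvd.2 hj).symm) ?_
      simp
    rw [← sum_mul_pow_eq_zero_of_coprime s c x (Nat.mul_pos hp.pos hM) hx hcop h]
    exact Finset.sum_congr rfl fun i _ => by ring
  by_cases hall : ∀ j < p, ¬ p ∣ 1 + M * j
  · have h := sum_inv_pow_mul_sum_mul_pow s (fun i => (c i : ℂ) * x i) (fun i => x i ^ M)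
      hp.pos hu hw
    rw [Finset.sum_eq_zero fun j hj => by
      rw [hT j (hall j (Finset.mem_range.1 hj)), mul_zero]] at h
    exact (mul_eq_zero.1 h.symm).resolve_left (Nat.cast_ne_zero.2 hp.ne_zero)
  · push Not at hall
    obtain ⟨j₀, hj₀, hdvd⟩ := hall
    have hnM : ¬ p ∣ M := fun hd => hp.one_lt.ne'
      (Nat.dvd_one.1 ((Nat.dvd_add_left (hd.mul_right j₀)).1 hdvd))
    have hcard := hpM.resolve_left hnM
    have hex : ∃ v ∈ Polynomial.nthRootsFinset p (1 : ℂ), v ∉ s.image fun i => x i ^ M := by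
      refine Finset.exists_mem_notMem_of_card_lt_card ?_
      rw [(Complex.isPrimitiveRoot_exp p hp.ne_zero).card_nthRootsFinset]
      exact Finset.card_image_le.trans_lt hcard
    obtain ⟨v, hv, hvs⟩ := hex
    refine sum_filter_eq_zero_of_missing s _ (fun i => x i ^ M) hp.pos hu j₀ (fun j hj hjj => ?_)
      ((Polynomial.mem_nthRootsFinset hp.pos _).1 hv)
      (fun i hi hiv => hvs (Finset.mem_image.2 ⟨i, hi, hiv⟩)) hw
    refine hT j fun hd => hjj ?_
    have hmod : M * j ≡ M * j₀ [MOD p] := Nat.ModEq.add_left_cancel' 1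
      (((Nat.modEq_zero_iff_dvd).2 hd).trans ((Nat.modEq_zero_iff_dvd).2 hdvd).symm)
    exact (Nat.ModEq.cancel_left_of_coprime ((hp.coprime_iff_not_dvd).2 hnM) hmod).eq_of_lt_of_lt
      hj hj₀

namespace ZeroRelation

theorem card_support_le_weight (a : ZeroRelation) : a.coeff.support.card ≤ a.weight := by
  rw [Finset.card_eq_sum_ones]
  exact Finset.sum_le_sum fun z hz => Nat.one_le_iff_ne_zero.2 (Finsupp.mem_support_iff.1 hz)

theorem exists_common_exponent (a : ZeroRelation) :
    ∃ N : ℕ, 0 < N ∧ ∀ η ∈ a.coeff.support, η ^ N = 1 := by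
  choose! m hm hpow using a.mem_rootsOfUnity
  refine ⟨∏ z ∈ a.coeff.support, m z, Finset.prod_pos hm, fun η hη => ?_⟩
  obtain ⟨d, hd⟩ := Finset.dvd_prod_of_mem m hη
  rw [hd, pow_mul, hpow η hη, one_pow]

/-- If some rotation of a minimal relation is supported in the `p * M`-th roots of unity and either
`p ∣ M` or `p` exceeds the weight, then some rotation is supported in the `M`-th roots of unity. -/
theorem IsMinimal.exists_rotation_of_mul {a : ZeroRelation} (hmin : a.IsMinimal) {p M : ℕ}
    (hp : p.Prime) (hM : 0 < M) (hpM : p ∣ M ∨ a.weight < p) {lam : ℂ} (hlam : lam ≠ 0)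
    (h : ∀ η ∈ a.coeff.support, (lam * η) ^ (p * M) = 1) :
    ∃ lam' : ℂ, (∃ m : ℕ, 0 < m ∧ lam' ^ m = 1) ∧
      ∀ η ∈ a.coeff.support, (lam' * η) ^ M = 1 := by
  obtain ⟨η₀, hη₀⟩ := Finsupp.support_nonempty_iff.2 a.ne_zero
  have hne : (lam * η₀) ^ M ≠ 0 := fun h0 => by
    have := h η₀ hη₀
    rw [mul_comm p M, pow_mul, h0, zero_pow hp.ne_zero] at this
    exact zero_ne_one this
  have hsum : ∑ η ∈ a.coeff.support, (a.coeff η : ℂ) * (lam * η) = 0 := by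
    have := congrArg (lam * ·) a.sum_zero
    simp only [Finsupp.sum, Finset.mul_sum, mul_zero] at this
    rw [← this]
    exact Finset.sum_congr rfl fun η _ => by ring
  have hfilter := sum_filter_pow_eq_zero a.coeff.support a.coeff (fun η => lam * η) hp hM h hsum
    (hpM.imp_right a.card_support_le_weight.trans_lt) (w := (lam * η₀) ^ M)
    (by rw [← pow_mul, mul_comm M p]; exact h η₀ hη₀)
  have hb := hmin (a.coeff.filter fun η => (lam * η) ^ M = (lam * η₀) ^ M)
    (fun z => by rw [Finsupp.filter_apply]; split_ifs <;> simp)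
    (by
      refine (mul_eq_zero.1 ?_).resolve_left hlam
      rw [← hfilter, Finsupp.sum, Finsupp.support_filter, Finset.mul_sum]
      refine Finset.sum_congr rfl fun η hη => ?_
      rw [Finsupp.filter_apply, if_pos (Finset.mem_filter.1 hη).2]
      ring)
  have hall : ∀ η ∈ a.coeff.support, (lam * η) ^ M = (lam * η₀) ^ M := by
    rcases hb with hb | hb
    · have := DFunLike.congr_fun hb η₀
      rw [Finsupp.filter_apply, if_pos rfl] at this
      exact absurd this (Finsupp.mem_support_iff.1 hη₀)
    · intro η hη
      rw [← hb, Finsupp.support_filter] at hη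
      exact (Finset.mem_filter.1 hη).2
  obtain ⟨m, hm, hpow⟩ := a.mem_rootsOfUnity η₀ hη₀
  refine ⟨η₀⁻¹, ⟨m, hm, by rw [inv_pow, hpow, inv_one]⟩, fun η hη => ?_⟩
  rw [inv_mul_eq_div, ← mul_div_mul_left η η₀ hlam, div_pow, hall η hη, div_self hne]

end ZeroRelation

theorem minimal_relation_support_in_squarefree_roots
    (a : ZeroRelation) (hmin : a.IsMinimal) (k : ℕ) (hk : a.weight = k) :
    ∃ (s : ℕ) (p : Fin s → ℕ), StrictMono p ∧ (∀ i, (p i).Prime ∧ p i ≤ k) ∧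
      ∃ lam : ℂ, (∃ m : ℕ, 0 < m ∧ lam ^ m = 1) ∧
        ∀ η ∈ a.coeff.support, (lam * η) ^ (∏ i : Fin s, p i) = 1 := by
  classical
  have hex : ∃ N : ℕ, 0 < N ∧ ∃ lam : ℂ, (∃ m : ℕ, 0 < m ∧ lam ^ m = 1) ∧
      ∀ η ∈ a.coeff.support, (lam * η) ^ N = 1 := by
    obtain ⟨N, hN, h⟩ := a.exists_common_exponent
    exact ⟨N, hN, 1, ⟨1, one_pos, one_pow 1⟩, by simpa using h⟩
  obtain ⟨hN, lam, hroot, hpow⟩ := Nat.find_spec hex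
  have hleast := fun {M : ℕ} => Nat.find_min hex (m := M)
  generalize Nat.find hex = N at hN hpow hleast
  have hlam : lam ≠ 0 := by
    rintro rfl
    obtain ⟨m, hm, h⟩ := hroot
    simp [hm.ne'] at h
  have hreduce : ∀ p M : ℕ, p.Prime → N = p * M → ¬ (p ∣ M ∨ k < p) := by
    rintro p M hp rfl hpM
    have hM : 0 < M := Nat.pos_of_mul_pos_left hN
    exact hleast (lt_mul_of_one_lt_left hM hp.one_lt)
      ⟨hM, hmin.exists_rotation_of_mul hp hM (hk ▸ hpM) hlam hpow⟩
  have hsq : Squarefree N := by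
    rw [Nat.squarefree_iff_prime_squarefree]
    rintro p hp ⟨d, hd⟩
    exact hreduce p (p * d) hp (by rw [hd, mul_assoc]) (Or.inl (dvd_mul_right p d))
  refine ⟨N.primeFactors.card, N.primeFactors.orderEmbOfFin rfl,
    (N.primeFactors.orderEmbOfFin rfl).strictMono, fun i => ?_, lam, hroot, fun η hη => ?_⟩
  · have hi := Nat.mem_primeFactors.1 (N.primeFactors.orderEmbOfFin_mem rfl i)
    refine ⟨hi.1, ?_⟩
    obtain ⟨M, hM⟩ := hi.2.1
    exact not_lt.1 fun hlt => hreduce _ M hi.1 hM (Or.inr hlt)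
  · have hprod : ∏ i, N.primeFactors.orderEmbOfFin rfl i = N := by
      conv_rhs => rw [← Nat.prod_primeFactors_of_squarefree hsq,
        ← Finset.image_orderEmbOfFin_univ N.primeFactors rfl,
        Finset.prod_image (N.primeFactors.orderEmbOfFin rfl).injective.injOn]
    rw [hprod]
    exact hpow η hη
end
end

section
/- Let p be a prime. Every minimal relation whose support consists of 2p-th roots of unity is, up to rotation, equal to R₂ (the relation 1 + (−1) = 0 with coefficients 1) or to R_p (the relation Σ_{i=0}^{p−1} ζ_p^i = 0 with all coefficients 1, where ζ_p = e^{2πi/p}). -/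
noncomputable section

/-- The relation `R_q : 1 + ζ_q + ζ_q² + ⋯ + ζ_q^{q-1} = 0`, as a finitely
supported function (`ζ_q = e^{2πi/q}`).  For `q = 2` this is `1 + (-1) = 0`. -/
def Rrel (q : ℕ) : ℂ →₀ ℕ :=
  ∑ i ∈ Finset.range q, Finsupp.single (Complex.exp (2 * Real.pi * Complex.I * i / q)) 1

open Polynomial in
/-- A vanishing integral combination of the `p`-th roots of unity is constant. -/
lemma IsPrimitiveRoot.eq_of_sum_int_mul_pow_eq_zero {p : ℕ} (hp : p.Prime) {ξ : ℂ}
    (hξ : IsPrimitiveRoot ξ p) (d : ℕ → ℤ)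
    (hd : ∑ i ∈ Finset.range p, (d i : ℂ) * ξ ^ i = 0) :
    ∀ i < p, d i = d (p - 1) := by
  have hfact : Fact p.Prime := ⟨hp⟩
  set e : ℕ → ℤ := fun i => d i - d (p - 1) with he
  have hsum : ∑ i ∈ Finset.range (p - 1), (e i : ℂ) * ξ ^ i = 0 := by
    have h1 : ∑ i ∈ Finset.range p, (e i : ℂ) * ξ ^ i = 0 := by
      simp only [he, Int.cast_sub, sub_mul, Finset.sum_sub_distrib, hd, ← Finset.mul_sum,
        hξ.geom_sum_eq_zero hp.one_lt, mul_zero, sub_zero]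
    rw [← Nat.sub_add_cancel hp.one_le, Finset.sum_range_succ] at h1
    simpa [he] using h1
  set P : ℚ[X] := ∑ i ∈ Finset.range (p - 1), C (e i : ℚ) * X ^ i with hP
  have hroot : aeval ξ P = 0 := by
    simpa [hP, map_sum] using hsum
  have hdeg : P.degree < (minpoly ℚ ξ).degree := by
    rw [← cyclotomic_eq_minpoly_rat hξ hp.pos, degree_cyclotomic, Nat.totient_prime hp]
    refine (degree_sum_le _ _).trans_lt ((Finset.sup_lt_iff ?_).2 fun i hi => ?_)
    · exact WithBot.bot_lt_coe _
    · refine (degree_C_mul_X_pow_le _ _).trans_lt ?_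
      exact_mod_cast Finset.mem_range.1 hi
  have hP0 : P = 0 := by
    by_contra h
    exact absurd (minpoly.degree_le_of_ne_zero ℚ ξ h hroot) (not_le.2 hdeg)
  intro i hi
  rcases (Nat.le_sub_one_of_lt hi).eq_or_lt with h | h
  · rw [h]
  · have hc : P.coeff i = e i := by
      simp [hP, coeff_X_pow, h]
    rw [hP0, coeff_zero] at hc
    have : e i = 0 := by exact_mod_cast hc.symm
    exact sub_eq_zero.1 this

lemma Rrel_eq_sum_pow (q : ℕ) :
    Rrel q = ∑ i ∈ Finset.range q,
      Finsupp.single (Complex.exp (2 * Real.pi * Complex.I / q) ^ i) 1 := by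
  refine Finset.sum_congr rfl fun i _ => ?_
  rw [← Complex.exp_nat_mul]
  congr 2
  ring

/-- A minimal relation containing a rotation of `R_q` is a rotation of `R_q`. -/
lemma ZeroRelation.IsMinimal.mapDomain_eq_Rrel {a : ZeroRelation} (hmin : a.IsMinimal)
    {q : ℕ} (hq : 1 < q) {w : ℂ} (hw : w ≠ 0)
    (h : ∀ i < q, 0 < a.coeff (w * Complex.exp (2 * Real.pi * Complex.I / q) ^ i)) :
    Finsupp.mapDomain (fun z => w⁻¹ * z) a.coeff = Rrel q := by
  have hζ := Complex.isPrimitiveRoot_exp q (by lia)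
  set ζ := Complex.exp (2 * Real.pi * Complex.I / q)
  set b : ℂ →₀ ℕ := ∑ i ∈ Finset.range q, Finsupp.single (w * ζ ^ i) 1 with hb
  have hmap : Finsupp.mapDomain (fun z => w⁻¹ * z) b = Rrel q := by
    rw [Rrel_eq_sum_pow, hb, Finsupp.mapDomain_finsetSum]
    refine Finset.sum_congr rfl fun i _ => ?_
    rw [Finsupp.mapDomain_single, inv_mul_cancel_left₀ hw]
  have hle : ∀ z, b z ≤ a.coeff z := by
    intro z
    have hbz : b z = ∑ i ∈ Finset.range q, if w * ζ ^ i = z then 1 else 0 := by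
      simp [hb, Finsupp.finsetSum_apply, Finsupp.single_apply]
    by_cases hz : ∃ i < q, w * ζ ^ i = z
    · obtain ⟨i, hi, rfl⟩ := hz
      rw [hbz, Finset.sum_eq_single_of_mem i (Finset.mem_range.2 hi)]
      · rw [if_pos rfl]
        exact h i hi
      · intro j hj hji
        refine if_neg fun hEq => hji ?_
        exact hζ.pow_inj (Finset.mem_range.1 hj) hi (mul_left_cancel₀ hw hEq)
    · rw [hbz, Finset.sum_eq_zero]
      · exact Nat.zero_le _
      · exact fun i hi => if_neg fun hEq => hz ⟨i, Finset.mem_range.1 hi, hEq⟩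
  have hsum : (b.sum fun z c => (c : ℂ) * z) = 0 := by
    rw [hb, ← Finsupp.sum_finsetSum_index (by simp) (by intros; push_cast; ring)]
    simp [← Finset.mul_sum, hζ.geom_sum_eq_zero hq]
  rcases hmin b hle hsum with h0 | h1
  · have hpos : 0 < b w := by
      have : (1 : ℕ) ≤ b w := by
        rw [hb, Finsupp.finsetSum_apply]
        refine le_trans ?_ (Finset.single_le_sum (fun _ _ => Nat.zero_le _)
          (Finset.mem_range.2 (show 0 < q by lia)))
        simp
      exact this
    simp [h0] at hpos
  · rw [← h1, hmap]

/-- A minimal relation containing an antipodal pair is a rotation of `R₂`. -/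
lemma ZeroRelation.IsMinimal.mapDomain_eq_Rrel_two {a : ZeroRelation} (hmin : a.IsMinimal)
    {w : ℂ} (hw : w ≠ 0) (h1 : 0 < a.coeff w) (h2 : 0 < a.coeff (-w)) :
    Finsupp.mapDomain (fun z => w⁻¹ * z) a.coeff = Rrel 2 := by
  refine hmin.mapDomain_eq_Rrel one_lt_two hw fun i hi => ?_
  have hexp : Complex.exp (2 * Real.pi * Complex.I / (2 : ℕ)) = -1 := by
    rw [← Complex.exp_pi_mul_I]
    congr 1
    push_cast
    ring
  rw [hexp]
  interval_cases i
  · simpa using h1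
  · simpa using h2

lemma IsPrimitiveRoot.pow_half_eq_neg_one {R : Type*} [CommRing R] [IsDomain R] {θ : R} {n : ℕ}
    (hn : 0 < n) (hθ : IsPrimitiveRoot θ (2 * n)) : θ ^ n = -1 := by
  have h : (θ ^ n) ^ 2 = 1 := by rw [← pow_mul, mul_comm, hθ.pow_eq_one]
  exact (mul_self_eq_one_iff.1 (by rwa [← sq])).resolve_left (hθ.pow_ne_one_of_pos_of_lt hn.ne' (by lia))

/-- The sum of a relation among `2n`-th roots of unity, with antipodal terms collected. -/
lemma ZeroRelation.sum_sub_mul_pow_eq_zero (a : ZeroRelation) {n : ℕ} (hn : 0 < n) {θ : ℂ}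
    (hθ : IsPrimitiveRoot θ (2 * n)) (hsupp : ∀ z ∈ a.coeff.support, z ^ (2 * n) = 1) :
    ∑ i ∈ Finset.range n,
      (((a.coeff (θ ^ i) : ℤ) - (a.coeff (-θ ^ i) : ℤ) : ℤ) : ℂ) * θ ^ i = 0 := by
  have hsub : a.coeff.support ⊆ (Finset.range (2 * n)).image (θ ^ ·) := by
    intro z hz
    have : NeZero (2 * n) := ⟨by lia⟩
    obtain ⟨i, hi, rfl⟩ := hθ.eq_pow_of_pow_eq_one (hsupp z hz)
    exact Finset.mem_image_of_mem _ (Finset.mem_range.2 hi)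
  have h := a.sum_zero
  rw [Finsupp.sum_of_support_subset _ hsub _ (by simp), Finset.sum_image, two_mul,
    Finset.sum_range_add, ← Finset.sum_add_distrib] at h
  · rw [← h]
    refine Finset.sum_congr rfl fun i _ => ?_
    rw [pow_add, hθ.pow_half_eq_neg_one hn, neg_one_mul]
    push_cast
    ring
  · intro i hi j hj hij
    exact hθ.pow_inj (by simpa using hi) (by simpa using hj) hij

/-- If antipodal coefficients agree, then the relation contains an antipodal pair. -/
lemma ZeroRelation.exists_antipodal (a : ZeroRelation) {n : ℕ} (hn : 0 < n) {θ : ℂ}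
    (hθ : IsPrimitiveRoot θ (2 * n)) (hsupp : ∀ z ∈ a.coeff.support, z ^ (2 * n) = 1)
    (h : ∀ i < n, a.coeff (θ ^ i) = a.coeff (-θ ^ i)) :
    ∃ w, w ^ (2 * n) = 1 ∧ 0 < a.coeff w ∧ 0 < a.coeff (-w) := by
  obtain ⟨w, hw⟩ := Finsupp.support_nonempty_iff.2 a.ne_zero
  have hpos : 0 < a.coeff w := Nat.pos_of_ne_zero (Finsupp.mem_support_iff.1 hw)
  refine ⟨w, hsupp w hw, hpos, ?_⟩
  have : NeZero (2 * n) := ⟨by lia⟩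
  obtain ⟨i, hi, rfl⟩ := hθ.eq_pow_of_pow_eq_one (hsupp w hw)
  rcases lt_or_ge i n with hin | hin
  · rwa [← h i hin]
  · obtain ⟨j, rfl⟩ := Nat.exists_eq_add_of_le hin
    rw [pow_add, hθ.pow_half_eq_neg_one hn, neg_one_mul] at hpos ⊢
    rwa [neg_neg, h j (by lia)]

lemma IsPrimitiveRoot.neg_of_odd {ξ : ℂ} {n : ℕ} (hn : Odd n) (hξ : IsPrimitiveRoot ξ n) :
    IsPrimitiveRoot (-ξ) (2 * n) := by
  have h2 : orderOf (-1 : ℂ) = 2 := by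
    simp [orderOf_neg_one]
  have h := (Commute.all (-1 : ℂ) ξ).orderOf_mul_eq_mul_orderOf_of_coprime
    (by rw [h2, ← hξ.eq_orderOf]; exact hn.coprime_two_left)
  rw [h2, ← hξ.eq_orderOf, neg_one_mul] at h
  rw [← h]
  exact IsPrimitiveRoot.orderOf _

theorem minimal_relation_in_2p_roots (p : ℕ) (hp : p.Prime)
    (a : ZeroRelation) (hsupp : ∀ z ∈ a.coeff.support, z ^ (2 * p) = 1)
    (hmin : a.IsMinimal) :
    ∃ lam : ℂ, (∃ m : ℕ, 0 < m ∧ lam ^ m = 1) ∧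
      (Finsupp.mapDomain (fun z => lam * z) a.coeff = Rrel 2 ∨
       Finsupp.mapDomain (fun z => lam * z) a.coeff = Rrel p) := by
  have hθ' : ∃ θ : ℂ, IsPrimitiveRoot θ (2 * p) ∧
      ((∀ i < p, a.coeff (θ ^ i) = a.coeff (-θ ^ i)) ∨
        ∃ w : ℂ, w ^ 2 = 1 ∧
          ∀ i < p, 0 < a.coeff (w * Complex.exp (2 * Real.pi * Complex.I / p) ^ i)) := by
    rcases hp.eq_two_or_odd' with rfl | hodd
    · have hθ := Complex.isPrimitiveRoot_exp (2 * 2) (by norm_num)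
      refine ⟨_, hθ, Or.inl ?_⟩
      set θ := Complex.exp (2 * Real.pi * Complex.I / (2 * 2 : ℕ))
      have hsum := a.sum_sub_mul_pow_eq_zero two_pos hθ hsupp
      have hsq := hθ.pow_half_eq_neg_one two_pos
      set d : ℕ → ℤ := fun i => (a.coeff (θ ^ i) : ℤ) - (a.coeff (-θ ^ i) : ℤ) with hd
      have h01 : (d 0 : ℂ) + d 1 * θ = 0 := by
        have h : ∑ i ∈ Finset.range 2, (d i : ℂ) * θ ^ i = 0 := hsum
        simpa only [Finset.sum_range_succ, Finset.sum_range_zero, zero_add, pow_zero, mul_one,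
          pow_one] using h
      have hnorm : d 0 ^ 2 + d 1 ^ 2 = 0 := by
        have : (d 0 : ℂ) ^ 2 + (d 1 : ℂ) ^ 2 = 0 := by
          linear_combination (d 0 - d 1 * θ : ℂ) * h01 + (d 1 : ℂ) ^ 2 * hsq
        exact_mod_cast this
      have hd0 : d 0 = 0 := by nlinarith [sq_nonneg (d 0), sq_nonneg (d 1)]
      have hd1 : d 1 = 0 := by nlinarith [sq_nonneg (d 0), sq_nonneg (d 1)]
      intro i hi
      have : d i = 0 := by interval_cases i <;> assumption
      exact_mod_cast sub_eq_zero.1 this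
    · have hξ := Complex.isPrimitiveRoot_exp p hp.ne_zero
      set ξ := Complex.exp (2 * Real.pi * Complex.I / p)
      have hθ := hξ.neg_of_odd hodd
      refine ⟨-ξ, hθ, ?_⟩
      have hsum := a.sum_sub_mul_pow_eq_zero hp.pos hθ hsupp
      set d : ℕ → ℤ := fun i => (a.coeff (ξ ^ i) : ℤ) - (a.coeff (-ξ ^ i) : ℤ) with hd
      have hterm : ∑ i ∈ Finset.range p, (d i : ℂ) * ξ ^ i = 0 := by
        rw [← hsum]
        refine Finset.sum_congr rfl fun i _ => ?_
        rcases i.even_or_odd with hi | hi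
        · rw [hi.neg_pow]
        · rw [hi.neg_pow, neg_neg]
          simp only [hd]
          push_cast
          ring
      have hconst := hξ.eq_of_sum_int_mul_pow_eq_zero hp d hterm
      rcases lt_trichotomy (d (p - 1)) 0 with hk | hk | hk
      · refine Or.inr ⟨-1, by norm_num, fun i hi => ?_⟩
        have := hconst i hi
        rw [neg_one_mul]
        simp only [hd] at this hk
        lia
      · refine Or.inl fun i hi => ?_
        have := hconst i hi
        rw [hk] at this
        have h : a.coeff (ξ ^ i) = a.coeff (-ξ ^ i) := by
          exact_mod_cast sub_eq_zero.1 this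
        rcases i.even_or_odd with he | ho
        · rwa [he.neg_pow]
        · rw [ho.neg_pow, neg_neg, h]
      · refine Or.inr ⟨1, by norm_num, fun i hi => ?_⟩
        have := hconst i hi
        rw [one_mul]
        simp only [hd] at this hk
        lia
  obtain ⟨θ, hθ, h | ⟨w, hw, h⟩⟩ := hθ'
  · obtain ⟨w, hw, h1, h2⟩ := a.exists_antipodal hp.pos hθ hsupp h
    have hw0 : w ≠ 0 := by
      rintro rfl
      simp [hp.ne_zero] at hw
    exact ⟨w⁻¹, ⟨2 * p, by have := hp.pos; lia, by rw [inv_pow, hw, inv_one]⟩,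
      Or.inl (hmin.mapDomain_eq_Rrel_two hw0 h1 h2)⟩
  · have hw0 : w ≠ 0 := by
      rintro rfl
      norm_num at hw
    exact ⟨w⁻¹, ⟨2, two_pos, by rw [inv_pow, hw, inv_one]⟩,
      Or.inr (hmin.mapDomain_eq_Rrel hp.one_lt hw0 h)⟩
end
end
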